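/- arXiv:2212.02758 — 4 statements merged into one kernel-verified Lean document; each statement's English description precedes it below -/
import Mathlib

section
/- Convergence of FedNH local training (Theorem 1). Let F : ℝ^{d₁} × ℝ^{d₂} → ℝ be bounded below by F*, L_g-smooth in its first argument, and L_W-Lipschitz in its second argument uniformly in the first. Let W⁰, W¹, …, W^{R−1} ∈ ℝ^{d₂} satisfy ‖W^{t+1} − W^t‖ ≤ δ for all t. On a probability space define iterates by θ^{t,j+1} = θ^{t,j} − η G^{t,j} for j = 0, …, J−1 and θ^{t+1,0} = θ^{t,J}, where, conditionally on the past, G^{t,j} has mean ∇_θF(θ^{t,j}; W^t) and conditional variance E[‖G^{t,j} − ∇_θF(θ^{t,j}; W^t)‖²] ≤ σ². Fix ε > 0. If η ≤ min(1/L_g, ε/(3 L_g σ²)), δ ≤ ε η J/(6 L_W), and R ≥ 6 (F(θ^{0,0}; W⁰) − F*)/(ε η J), then (1/(R J)) Σ_{t=0}^{R−1} Σ_{j=0}^{J−1} E[‖∇_θF(θ^{t,j}; W^t)‖²] ≤ ε; equivalently, an iterate index chosen uniformly at random and independently of the algorithm satisfies E[‖∇_θF(θ^{t,j}; W^t)‖²]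 ≤ ε. -/
open MeasureTheory Finset

lemma fednh_descent {E : Type*} [NormedAddCommGroup E] [InnerProductSpace ℝ E] [CompleteSpace E]
    (f : E → ℝ) (L : ℝ) (hd : Differentiable ℝ f)
    (hs : ∀ x y, ‖gradient f x - gradient f y‖ ≤ L * ‖x - y‖) (x v : E) :
    f (x + v) ≤ f x + inner ℝ (gradient f x) v + L / 2 * ‖v‖ ^ 2 := by
  have hder : ∀ s : ℝ, HasDerivAt
      (fun s : ℝ => f (x + s • v) - s * inner ℝ (gradient f x) v - L / 2 * ‖v‖ ^ 2 * s ^ 2)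
      (inner ℝ (gradient f (x + s • v)) v - inner ℝ (gradient f x) v
        - L / 2 * ‖v‖ ^ 2 * (2 * s)) s := by
    intro s
    have h1 : HasDerivAt (fun s : ℝ => x + s • v) v s := by
      simpa using ((hasDerivAt_id s).smul_const v).const_add x
    have h2 : HasDerivAt (fun s : ℝ => f (x + s • v)) (inner ℝ (gradient f (x + s • v)) v) s := by
      have := (hd (x + s • v)).hasFDerivAt.comp_hasDerivAt s h1
      rw [inner_gradient_left]
      exact this
    have h3 : HasDerivAt (fun s : ℝ => s * inner ℝ (gradient f x) v)
        (inner ℝ (gradient f x) v) s := by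
      simpa using (hasDerivAt_id s).mul_const (inner ℝ (gradient f x) v)
    have h4 : HasDerivAt (fun s : ℝ => L / 2 * ‖v‖ ^ 2 * s ^ 2)
        (L / 2 * ‖v‖ ^ 2 * (2 * s)) s := by
      simpa using (hasDerivAt_pow 2 s).const_mul (L / 2 * ‖v‖ ^ 2)
    exact (h2.sub h3).sub h4
  have hanti := antitoneOn_of_deriv_nonpos (convex_Icc (0 : ℝ) 1)
    (fun s _ => (hder s).continuousAt.continuousWithinAt)
    (fun s _ => (hder s).differentiableAt.differentiableWithinAt) (by
      intro s hs'
      rw [interior_Icc] at hs'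
      rw [(hder s).deriv, ← inner_sub_left]
      have h1 := real_inner_le_norm (gradient f (x + s • v) - gradient f x) v
      have h2 := hs (x + s • v) x
      rw [add_sub_cancel_left, norm_smul, Real.norm_of_nonneg hs'.1.le] at h2
      nlinarith [norm_nonneg v, mul_le_mul_of_nonneg_right h2 (norm_nonneg v)])
  have := hanti (Set.left_mem_Icc.2 zero_le_one) (Set.right_mem_Icc.2 zero_le_one) zero_le_one
  simp at this
  rw [inner_gradient_left]
  linarith

lemma fednh_step {E : Type*} [NormedAddCommGroup E] [InnerProductSpace ℝ E] [CompleteSpace E]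
    {Ω : Type*} (m : MeasurableSpace Ω) [m0 : MeasurableSpace Ω] {μ : Measure Ω} [IsProbabilityMeasure μ]
    (f : E → ℝ) (L σ η : ℝ) (hL : 0 < L) (hη0 : 0 < η) (hη : η ≤ 1 / L)
    (hd : Differentiable ℝ f)
    (hs : ∀ x y, ‖gradient f x - gradient f y‖ ≤ L * ‖x - y‖)
    (hm : m ≤ m0) (x G : Ω → E)
    (hx : StronglyMeasurable[m] x) (hG : Integrable G μ)
    (hv : Integrable (fun ω => ‖G ω - gradient f (x ω)‖ ^ 2) μ)
    (hf : Integrable (fun ω => f (x ω)) μ)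
    (hf' : Integrable (fun ω => f (x ω - η • G ω)) μ)
    (hg : Integrable (fun ω => ‖gradient f (x ω)‖ ^ 2) μ)
    (hmean : μ[G | m] =ᵐ[μ] fun ω => gradient f (x ω))
    (hvar : μ[(fun ω => ‖G ω - gradient f (x ω)‖ ^ 2) | m] ≤ᵐ[μ] fun _ => σ ^ 2) :
    η / 2 * ∫ ω, ‖gradient f (x ω)‖ ^ 2 ∂μ ≤
      (∫ ω, f (x ω) ∂μ) - (∫ ω, f (x ω - η • G ω) ∂μ) + L * η ^ 2 * σ ^ 2 / 2 := by
  have hcont : Continuous (gradient f) := by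
    have : LipschitzWith (Real.toNNReal L) (gradient f) := by
      apply LipschitzWith.of_dist_le_mul
      intro a b
      rw [dist_eq_norm, dist_eq_norm, Real.coe_toNNReal _ hL.le]
      exact hs a b
    exact this.continuous
  have hgm : StronglyMeasurable[m] (fun ω => gradient f (x ω)) := hcont.comp_stronglyMeasurable hx
  have hgm0 : AEStronglyMeasurable (fun ω => gradient f (x ω)) μ :=
    (hgm.mono hm).aestronglyMeasurable
  have hin : Integrable (fun ω => inner ℝ (gradient f (x ω)) (G ω)) μ := by
    refine Integrable.mono' (g := fun ω => ‖gradient f (x ω)‖ ^ 2 +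
      (‖gradient f (x ω)‖ ^ 2 + ‖G ω - gradient f (x ω)‖ ^ 2)) (hg.add (hg.add hv))
      (hgm0.inner hG.aestronglyMeasurable) (ae_of_all _ fun ω => ?_)
    have h1 : inner ℝ (gradient f (x ω)) (G ω) =
        ‖gradient f (x ω)‖ ^ 2 + inner ℝ (gradient f (x ω)) (G ω - gradient f (x ω)) := by
      rw [inner_sub_right, real_inner_self_eq_norm_sq]; ring
    have h2 := abs_real_inner_le_norm (gradient f (x ω)) (G ω - gradient f (x ω))
    rw [h1, Real.norm_eq_abs]
    have h3 := abs_add_le (‖gradient f (x ω)‖ ^ 2)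
      (inner ℝ (gradient f (x ω)) (G ω - gradient f (x ω)))
    rw [abs_of_nonneg (sq_nonneg ‖gradient f (x ω)‖)] at h3
    nlinarith [sq_nonneg (‖gradient f (x ω)‖ - ‖G ω - gradient f (x ω)‖),
      sq_nonneg ‖gradient f (x ω)‖, sq_nonneg ‖G ω - gradient f (x ω)‖]
  have hinner : ∫ ω, inner ℝ (gradient f (x ω)) (G ω) ∂μ = ∫ ω, ‖gradient f (x ω)‖ ^ 2 ∂μ := by
    have h := condExp_bilin_of_stronglyMeasurable_left (μ := μ) (innerSL ℝ : E →L[ℝ] E →L[ℝ] ℝ) hgm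
      hin hG
    change μ[fun ω => inner ℝ (gradient f (x ω)) (G ω) | m] =ᵐ[μ]
      fun ω => inner ℝ (gradient f (x ω)) (μ[G | m] ω) at h
    rw [← integral_condExp hm (f := fun ω => inner ℝ (gradient f (x ω)) (G ω)), integral_congr_ae h]
    apply integral_congr_ae
    filter_upwards [hmean] with ω hω
    rw [hω, real_inner_self_eq_norm_sq]
  have hvar' : ∫ ω, ‖G ω - gradient f (x ω)‖ ^ 2 ∂μ ≤ σ ^ 2 := by
    rw [← integral_condExp hm]
    calc _ ≤ ∫ _, σ ^ 2 ∂μ := integral_mono_ae integrable_condExp (integrable_const _) hvar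
      _ = σ ^ 2 := by simp
  have hpt : ∀ ω, f (x ω - η • G ω) ≤ f (x ω) + ((L * η ^ 2 - η) * inner ℝ (gradient f (x ω)) (G ω)
      + (L * η ^ 2 / 2 * ‖G ω - gradient f (x ω)‖ ^ 2
        + (- (L * η ^ 2 / 2)) * ‖gradient f (x ω)‖ ^ 2)) := by
    intro ω
    have h := fednh_descent f L hd hs (x ω) (-(η • G ω))
    rw [← sub_eq_add_neg, inner_neg_right, inner_smul_right, norm_neg, norm_smul, mul_pow,
      Real.norm_of_nonneg hη0.le] at h
    have h2 := norm_sub_sq_real (G ω) (gradient f (x ω))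
    rw [real_inner_comm] at h2
    rw [h2]
    linarith
  have hi1 := hin.const_mul (L * η ^ 2 - η)
  have hi2 := hv.const_mul (L * η ^ 2 / 2)
  have hi3 := hg.const_mul (- (L * η ^ 2 / 2))
  have hint := integral_mono hf' (hf.add (hi1.add (hi2.add hi3))) hpt
  rw [integral_add' hf (hi1.add (hi2.add hi3)), integral_add' hi1 (hi2.add hi3),
    integral_add' hi2 hi3, integral_const_mul, integral_const_mul, integral_const_mul, hinner]
    at hint
  have hS : 0 ≤ ∫ ω, ‖gradient f (x ω)‖ ^ 2 ∂μ := integral_nonneg fun ω => sq_nonneg _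
  have hLη : L * η ≤ 1 := by
    rw [le_div_iff₀ hL] at hη; linarith
  have hc : 0 ≤ L * η ^ 2 / 2 := by positivity
  have h5 := mul_le_mul_of_nonneg_left hvar' hc
  have h6 : L * η ^ 2 ≤ η := by nlinarith
  have h7 := mul_le_mul_of_nonneg_right h6 hS
  linarith

/-- **Convergence of FedNH local training (Theorem 1).**
`F` is bounded below by `Fstar`, `Lg`-smooth in its first argument and `LW`-Lipschitz
in its second argument uniformly in the first.  The heads `W t` drift by at most `δ`
per round, and in each of `R` rounds a client performs `J` stochastic gradient steps
with step size `η` on `F (·, W t)`, where conditionally on the past (encoded by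
`𝒢 t j`) the stochastic gradients are unbiased with conditional variance at most
`σ²`.  If `η ≤ min (1/Lg) (ε/(3 Lg σ²))`, `δ ≤ ε η J/(6 LW)` and
`R ≥ 6 (F(θ₀; W⁰) − Fstar)/(ε η J)`, then the average expected squared gradient
norm over all iterates (equivalently, the expected squared gradient norm at an
iterate chosen uniformly at random, independently of the algorithm) is at most `ε`. -/
theorem fednh_convergence
    {d₁ d₂ : ℕ} {Ω : Type*} [m0 : MeasurableSpace Ω]
    {μ : Measure Ω} [IsProbabilityMeasure μ]
    (F : EuclideanSpace ℝ (Fin d₁) → EuclideanSpace ℝ (Fin d₂) → ℝ)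
    (Fstar Lg LW σ η δ ε : ℝ) (R J : ℕ)
    (hLg : 0 < Lg) (hLW : 0 ≤ LW) (hδ : 0 ≤ δ) (hε : 0 < ε)
    (hη0 : 0 < η) (hη : η ≤ min (1 / Lg) (ε / (3 * Lg * σ ^ 2)))
    (hbdd : ∀ θ W, Fstar ≤ F θ W)
    (hdiff : ∀ W, Differentiable ℝ (fun θ => F θ W))
    (hsmooth : ∀ (W : EuclideanSpace ℝ (Fin d₂)) (θ₁ θ₂ : EuclideanSpace ℝ (Fin d₁)),
      ‖gradient (fun θ => F θ W) θ₁ - gradient (fun θ => F θ W) θ₂‖ ≤ Lg * ‖θ₁ - θ₂‖)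
    (hLip : ∀ (θ : EuclideanSpace ℝ (Fin d₁)) (W W' : EuclideanSpace ℝ (Fin d₂)),
      |F θ W - F θ W'| ≤ LW * ‖W - W'‖)
    (W : ℕ → EuclideanSpace ℝ (Fin d₂))
    (hW : ∀ t, t + 1 < R → ‖W (t + 1) - W t‖ ≤ δ)
    (𝒢 : ℕ → ℕ → MeasurableSpace Ω)
    (h𝒢 : ∀ t j, 𝒢 t j ≤ m0)
    (h𝒢mono : ∀ t j, 𝒢 t j ≤ 𝒢 t (j + 1))
    (h𝒢link : ∀ t, 𝒢 t J ≤ 𝒢 (t + 1) 0)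
    (θ G : ℕ → ℕ → Ω → EuclideanSpace ℝ (Fin d₁))
    (θ₀ : EuclideanSpace ℝ (Fin d₁)) (hinit : θ 0 0 = fun _ => θ₀)
    (hδε : δ ≤ ε * η * J / (6 * LW))
    (hR : 6 * (F θ₀ (W 0) - Fstar) / (ε * η * J) ≤ (R : ℝ))
    (hupd : ∀ t, t < R → ∀ j, j < J → θ t (j + 1) = fun ω => θ t j ω - η • G t j ω)
    (hlink : ∀ t, t + 1 < R → θ (t + 1) 0 = θ t J)
    (hadapt : ∀ t j, StronglyMeasurable[𝒢 t j] (θ t j))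
    (hGint : ∀ t j, Integrable (G t j) μ)
    (hvarint : ∀ t j,
      Integrable (fun ω => ‖G t j ω - gradient (fun θ' => F θ' (W t)) (θ t j ω)‖ ^ 2) μ)
    (hFint : ∀ t j, Integrable (fun ω => F (θ t j ω) (W t)) μ)
    (hgradint : ∀ t j,
      Integrable (fun ω => ‖gradient (fun θ' => F θ' (W t)) (θ t j ω)‖ ^ 2) μ)
    (hmean : ∀ t, t < R → ∀ j, j < J →
      μ[G t j | 𝒢 t j] =ᵐ[μ] fun ω => gradient (fun θ' => F θ' (W t)) (θ t j ω))
    (hvar : ∀ t, t < R → ∀ j, j < J →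
      μ[(fun ω => ‖G t j ω - gradient (fun θ' => F θ' (W t)) (θ t j ω)‖ ^ 2) | 𝒢 t j]
        ≤ᵐ[μ] fun _ => σ ^ 2) :
    (1 / ((R : ℝ) * (J : ℝ))) *
        ∑ t ∈ range R, ∑ j ∈ range J,
          ∫ ω, ‖gradient (fun θ' => F θ' (W t)) (θ t j ω)‖ ^ 2 ∂μ
      ≤ ε := by
  rcases Nat.eq_zero_or_pos R with hR0 | hRpos
  · simp [hR0, hε.le]
  rcases Nat.eq_zero_or_pos J with hJ0 | hJpos
  · simp [hJ0, hε.le]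
  have hRr : (0 : ℝ) < R := by exact_mod_cast hRpos
  have hJr : (0 : ℝ) < J := by exact_mod_cast hJpos
  obtain ⟨hη1, hη2⟩ := le_min_iff.1 hη
  have hσ : 0 < 3 * Lg * σ ^ 2 := by
    by_contra hcon
    have h0 : 3 * Lg * σ ^ 2 = 0 := le_antisymm (not_lt.1 hcon) (by positivity)
    rw [h0, div_zero] at hη2
    linarith
  have hησ : Lg * η ^ 2 * σ ^ 2 / 2 ≤ ε * η / 6 := by
    rw [le_div_iff₀ hσ] at hη2
    nlinarith
  have hLδ : LW * δ ≤ ε * η * J / 6 := by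
    rcases hLW.eq_or_lt with h | h
    · rw [← h, zero_mul]; positivity
    · rw [le_div_iff₀ (by positivity)] at hδε
      linarith
  have hF0 : F θ₀ (W 0) - Fstar ≤ R * (ε * η * J) / 6 := by
    rw [div_le_iff₀ (by positivity)] at hR
    linarith
  set S : ℕ → ℕ → ℝ := fun t j =>
    ∫ ω, ‖gradient (fun θ' => F θ' (W t)) (θ t j ω)‖ ^ 2 ∂μ with hS
  set a : ℕ → ℕ → ℝ := fun t j => ∫ ω, F (θ t j ω) (W t) ∂μ with ha
  have hstep : ∀ t, t < R → ∀ j, j < J →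
      η / 2 * S t j ≤ a t j - a t (j + 1) + ε * η / 6 := by
    intro t ht j hj
    have hf' := hFint t (j + 1)
    have he : a t (j + 1) = ∫ ω, F (θ t j ω - η • G t j ω) (W t) ∂μ := by
      simp only [ha, hupd t ht j hj]
    rw [hupd t ht j hj] at hf'
    have := fednh_step (𝒢 t j) (μ := μ) (fun θ' => F θ' (W t)) Lg σ η hLg hη0 hη1 (hdiff (W t))
      (hsmooth (W t)) (h𝒢 t j) (θ t j) (G t j) (hadapt t j) (hGint t j) (hvarint t j)
      (hFint t j) hf' (hgradint t j) (hmean t ht j hj) (hvar t ht j hj)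
    rw [he]
    linarith
  have hround : ∀ t, t < R → ∀ n, n ≤ J →
      η / 2 * ∑ j ∈ range n, S t j ≤ a t 0 - a t n + n * (ε * η / 6) := by
    intro t ht n
    induction n with
    | zero => intro _; simp
    | succ n ih =>
      intro hn
      have h1 := ih (by omega)
      have h2 := hstep t ht n (by omega)
      rw [Finset.sum_range_succ]
      push_cast
      linarith
  have hdrift : ∀ t, t + 1 < R → a (t + 1) 0 ≤ a t J + ε * η * J / 6 := by
    intro t ht
    have h1 : a (t + 1) 0 ≤ ∫ ω, (F (θ t J ω) (W t) + ε * η * J / 6) ∂μ := by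
      refine integral_mono (hFint (t + 1) 0) ((hFint t J).add (integrable_const _)) fun ω => ?_
      simp only [hlink t ht]
      have h2 := (abs_le.1 (hLip (θ t J ω) (W (t + 1)) (W t))).2
      have h3 := mul_le_mul_of_nonneg_left (hW t ht) hLW
      linarith
    rw [integral_add (hFint t J) (integrable_const _)] at h1
    simpa using h1
  have htot : ∀ n, n < R → η / 2 * ∑ t ∈ range (n + 1), ∑ j ∈ range J, S t j ≤
      a 0 0 - a n J + (n + 1) * (J * (ε * η / 6)) + n * (ε * η * J / 6) := by
    intro n
    induction n with
    | zero =>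
      intro h
      have := hround 0 h J le_rfl
      simpa using this
    | succ n ih =>
      intro h
      have h1 := ih (by omega)
      have h2 := hround (n + 1) h J le_rfl
      have h3 := hdrift n h
      rw [Finset.sum_range_succ]
      push_cast
      linarith
  have hfin := htot (R - 1) (by omega)
  have hcast : ((R - 1 : ℕ) : ℝ) = R - 1 := by
    rw [Nat.cast_sub hRpos]; simp
  rw [Nat.sub_add_cancel hRpos, hcast] at hfin
  have ha0 : a 0 0 = F θ₀ (W 0) := by simp [ha, hinit]
  have haR : Fstar ≤ a (R - 1) J := by
    have := integral_mono (μ := μ) (integrable_const Fstar) (hFint (R - 1) J)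
      (fun ω => hbdd _ _)
    simpa using this
  have hpos : 0 < ε * η * J / 6 := by positivity
  have hkey : η / 2 * ∑ t ∈ range R, ∑ j ∈ range J, S t j ≤ η / 2 * (ε * (R * J)) := by
    rw [ha0] at hfin
    nlinarith
  have hkey' := le_of_mul_le_mul_left hkey (by positivity)
  rw [one_div, inv_mul_le_iff₀ (by positivity)]
  linarith
end

section
/- Master bound for perturbed local SGD. Let F : ℝ^{d₁} × ℝ^{d₂} → ℝ be bounded below by F*, L_g-smooth in its first argument, and L_W-Lipschitz in its second argument uniformly in the first. Let W⁰, …, W^{R−1} ∈ ℝ^{d₂} satisfy ‖W^{t+1} − W^t‖ ≤ δ for all t. On a probability space define θ^{t,j+1} = θ^{t,j} − η G^{t,j} for j = 0, …, J−1 and θ^{t+1,0} = θ^{t,J}, where, conditionally on the past, G^{t,j} has mean ∇_θF(θ^{t,j}; W^t) and conditional variance at most σ². Then for any step size 0 < η < 2/L_g, Σ_{t=0}^{R−1} Σ_{j=0}^{J−1} E[‖∇_θF(θ^{t,j}; W^t)‖²] ≤ (F(θ^{0,0}; W⁰) − F* + R L_W δ + R J L_g η² σ²/2) / (η (1 − η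 L_g/2)). -/
open MeasureTheory Finset

lemma aux_descent {E : Type*} [NormedAddCommGroup E] [InnerProductSpace ℝ E] [CompleteSpace E]
    (f : E → ℝ) (L : ℝ) (hf : Differentiable ℝ f)
    (hs : ∀ x y, ‖gradient f x - gradient f y‖ ≤ L * ‖x - y‖) (x v : E) :
    f (x + v) ≤ f x + inner ℝ (gradient f x) v + L / 2 * ‖v‖ ^ 2 := by
  have hd : ∀ s : ℝ, HasDerivAt
      (fun s : ℝ => f (x + s • v) - s * inner ℝ (gradient f x) v - s ^ 2 * (L / 2 * ‖v‖ ^ 2))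
      (inner ℝ (gradient f (x + s • v)) v - inner ℝ (gradient f x) v
        - 2 * s * (L / 2 * ‖v‖ ^ 2)) s := by
    intro s
    have h1 : HasDerivAt (fun s : ℝ => x + s • v) v s := by
      simpa using ((hasDerivAt_id s).smul_const v).const_add x
    have h2 := (hf (x + s • v)).hasGradientAt.hasFDerivAt.comp_hasDerivAt s h1
    have h3 := (hasDerivAt_id s).mul_const (inner ℝ (gradient f x) v)
    have h4 := (hasDerivAt_pow 2 s).mul_const (L / 2 * ‖v‖ ^ 2)
    have h5 := (h2.sub h3).sub h4
    convert! h5 using 1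
    simp
  have hanti := antitoneOn_of_deriv_nonpos (convex_Icc (0:ℝ) 1)
    (fun s _ => (hd s).continuousAt.continuousWithinAt)
    (fun s _ => (hd s).differentiableAt.differentiableWithinAt)
    (by
      intro s hs'
      rw [interior_Icc] at hs'
      rw [(hd s).deriv, ← inner_sub_left]
      have h1 := real_inner_le_norm (gradient f (x + s • v) - gradient f x) v
      have h2 := hs (x + s • v) x
      rw [add_sub_cancel_left, norm_smul, Real.norm_of_nonneg hs'.1.le] at h2
      have h3 := mul_le_mul_of_nonneg_right h2 (norm_nonneg v)
      nlinarith)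
  have := hanti (Set.left_mem_Icc.2 zero_le_one) (Set.right_mem_Icc.2 zero_le_one) zero_le_one
  simp only [zero_smul, one_smul, add_zero] at this
  linarith

lemma aux_step {d : ℕ} {Ω : Type*} [m0 : MeasurableSpace Ω]
    {μ : Measure Ω} [IsProbabilityMeasure μ]
    (f : EuclideanSpace ℝ (Fin d) → ℝ) (L σ η : ℝ) (hL : 0 < L)
    (hf : Differentiable ℝ f)
    (hs : ∀ x y, ‖gradient f x - gradient f y‖ ≤ L * ‖x - y‖)
    (m : MeasurableSpace Ω) (hm : m ≤ m0) (X G : Ω → EuclideanSpace ℝ (Fin d))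
    (hX : StronglyMeasurable[m] X) (hG : Integrable G μ)
    (hN : Integrable (fun ω => ‖G ω - gradient f (X ω)‖ ^ 2) μ)
    (hF : Integrable (fun ω => f (X ω)) μ)
    (hF' : Integrable (fun ω => f (X ω - η • G ω)) μ)
    (hA : Integrable (fun ω => ‖gradient f (X ω)‖ ^ 2) μ)
    (hmean : μ[G | m] =ᵐ[μ] fun ω => gradient f (X ω))
    (hvar : μ[(fun ω => ‖G ω - gradient f (X ω)‖ ^ 2) | m] ≤ᵐ[μ] fun _ => σ ^ 2) :
    (η * (1 - η * L / 2)) * ∫ ω, ‖gradient f (X ω)‖ ^ 2 ∂μ ≤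
      ∫ ω, f (X ω) ∂μ - ∫ ω, f (X ω - η • G ω) ∂μ + L * η ^ 2 * σ ^ 2 / 2 := by
  have hgc : Continuous (gradient f) := by
    have : LipschitzWith L.toNNReal (gradient f) := by
      apply LipschitzWith.of_dist_le_mul
      intro x y
      rw [dist_eq_norm, dist_eq_norm, Real.coe_toNNReal _ hL.le]
      exact hs x y
    exact this.continuous
  have hgm : StronglyMeasurable[m] (fun ω => gradient f (X ω)) :=
    hgc.comp_stronglyMeasurable hX
  have hI : Integrable (fun ω => inner ℝ (gradient f (X ω)) (G ω)) μ := by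
    refine Integrable.mono' ((hA.const_mul 2).add hN)
      ((hgm.mono hm).aestronglyMeasurable.inner hG.aestronglyMeasurable) (ae_of_all _ fun ω => ?_)
    have h1 := norm_inner_le_norm (𝕜 := ℝ) (gradient f (X ω)) (G ω)
    have h2 : ‖G ω‖ ≤ ‖G ω - gradient f (X ω)‖ + ‖gradient f (X ω)‖ := by
      simpa using norm_add_le (G ω - gradient f (X ω)) (gradient f (X ω))
    simp only [Pi.add_apply]
    have h3 := mul_le_mul_of_nonneg_left h2 (norm_nonneg (gradient f (X ω)))
    nlinarith [sq_nonneg (‖gradient f (X ω)‖ - ‖G ω - gradient f (X ω)‖),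
      sq_nonneg (‖gradient f (X ω)‖), sq_nonneg (‖G ω - gradient f (X ω)‖)]
  have hinner : ∫ ω, inner ℝ (gradient f (X ω)) (G ω) ∂μ = ∫ ω, ‖gradient f (X ω)‖ ^ 2 ∂μ := by
    rw [← integral_condExp hm]
    apply integral_congr_ae
    have hp : μ[fun ω => inner ℝ (gradient f (X ω)) (G ω) | m] =ᵐ[μ]
        fun ω => inner ℝ (gradient f (X ω)) (μ[G | m] ω) :=
      condExp_bilin_of_stronglyMeasurable_left (μ := μ) (innerSL ℝ) hgm hI hG
    filter_upwards [hp, hmean] with ω h1 h2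
    rw [h1, h2, real_inner_self_eq_norm_sq]
  have hV : ∫ ω, ‖G ω - gradient f (X ω)‖ ^ 2 ∂μ ≤ σ ^ 2 := by
    rw [← integral_condExp hm]
    refine (integral_mono_ae integrable_condExp (integrable_const _) hvar).trans ?_
    simp
  have hpt : ∀ ω, f (X ω - η • G ω) ≤ f (X ω)
      + (L * η ^ 2 - η) * inner ℝ (gradient f (X ω)) (G ω)
      + L * η ^ 2 / 2 * ‖G ω - gradient f (X ω)‖ ^ 2
      - L * η ^ 2 / 2 * ‖gradient f (X ω)‖ ^ 2 := by
    intro ω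
    have h := aux_descent f L hf hs (X ω) (-(η • G ω))
    rw [← sub_eq_add_neg, inner_neg_right, inner_smul_right, norm_neg, norm_smul, mul_pow,
      Real.norm_eq_abs, sq_abs] at h
    have h2 := norm_sub_sq_real (G ω) (gradient f (X ω))
    rw [real_inner_comm] at h2
    rw [h2]
    linarith
  have i1 := hI.const_mul (L * η ^ 2 - η)
  have i2 := hN.const_mul (L * η ^ 2 / 2)
  have i3 := hA.const_mul (L * η ^ 2 / 2)
  have hint := integral_mono hF' (((hF.add i1).add i2).sub i3) hpt
  simp only [Pi.add_apply, Pi.sub_apply] at hint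
  rw [integral_sub (by exact (hF.add i1).add i2) i3, integral_add (by exact hF.add i1) i2,
    integral_add hF i1, integral_const_mul, integral_const_mul, integral_const_mul, hinner] at hint
  have := mul_le_mul_of_nonneg_left hV (show 0 ≤ L * η ^ 2 / 2 by positivity)
  linarith

/-- **Master bound for perturbed local SGD (FedNH).**
`F` is bounded below by `Fstar`, `Lg`-smooth in its first argument and `LW`-Lipschitz
in its second argument uniformly in the first.  The heads `W t` drift by at most `δ`
per round, and in each of `R` rounds a client performs `J` stochastic gradient steps
with step size `η ∈ (0, 2/Lg)` on `F (·, W t)`, where conditionally on the past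
(encoded by `𝒢 t j`) the stochastic gradients are unbiased with conditional variance
at most `σ²`.  Then the accumulated expected squared gradient norms satisfy the
stated bound. -/
theorem fednh_master_bound
    {d₁ d₂ : ℕ} {Ω : Type*} [m0 : MeasurableSpace Ω]
    {μ : Measure Ω} [IsProbabilityMeasure μ]
    (F : EuclideanSpace ℝ (Fin d₁) → EuclideanSpace ℝ (Fin d₂) → ℝ)
    (Fstar Lg LW σ η δ : ℝ) (R J : ℕ)
    (hLg : 0 < Lg) (hLW : 0 ≤ LW) (hδ : 0 ≤ δ)
    (hη0 : 0 < η) (hη2 : η < 2 / Lg)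
    (hbdd : ∀ θ W, Fstar ≤ F θ W)
    (hdiff : ∀ W, Differentiable ℝ (fun θ => F θ W))
    (hsmooth : ∀ (W : EuclideanSpace ℝ (Fin d₂)) (θ₁ θ₂ : EuclideanSpace ℝ (Fin d₁)),
      ‖gradient (fun θ => F θ W) θ₁ - gradient (fun θ => F θ W) θ₂‖ ≤ Lg * ‖θ₁ - θ₂‖)
    (hLip : ∀ (θ : EuclideanSpace ℝ (Fin d₁)) (W W' : EuclideanSpace ℝ (Fin d₂)),
      |F θ W - F θ W'| ≤ LW * ‖W - W'‖)
    (W : ℕ → EuclideanSpace ℝ (Fin d₂))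
    (hW : ∀ t, t + 1 < R → ‖W (t + 1) - W t‖ ≤ δ)
    (𝒢 : ℕ → ℕ → MeasurableSpace Ω)
    (h𝒢 : ∀ t j, 𝒢 t j ≤ m0)
    (h𝒢mono : ∀ t j, 𝒢 t j ≤ 𝒢 t (j + 1))
    (h𝒢link : ∀ t, 𝒢 t J ≤ 𝒢 (t + 1) 0)
    (θ G : ℕ → ℕ → Ω → EuclideanSpace ℝ (Fin d₁))
    (θ₀ : EuclideanSpace ℝ (Fin d₁)) (hinit : θ 0 0 = fun _ => θ₀)
    (hupd : ∀ t, t < R → ∀ j, j < J → θ t (j + 1) = fun ω => θ t j ω - η • G t j ω)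
    (hlink : ∀ t, t + 1 < R → θ (t + 1) 0 = θ t J)
    (hadapt : ∀ t j, StronglyMeasurable[𝒢 t j] (θ t j))
    (hGint : ∀ t j, Integrable (G t j) μ)
    (hvarint : ∀ t j,
      Integrable (fun ω => ‖G t j ω - gradient (fun θ' => F θ' (W t)) (θ t j ω)‖ ^ 2) μ)
    (hFint : ∀ t j, Integrable (fun ω => F (θ t j ω) (W t)) μ)
    (hgradint : ∀ t j,
      Integrable (fun ω => ‖gradient (fun θ' => F θ' (W t)) (θ t j ω)‖ ^ 2) μ)
    (hmean : ∀ t, t < R → ∀ j, j < J →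
      μ[G t j | 𝒢 t j] =ᵐ[μ] fun ω => gradient (fun θ' => F θ' (W t)) (θ t j ω))
    (hvar : ∀ t, t < R → ∀ j, j < J →
      μ[(fun ω => ‖G t j ω - gradient (fun θ' => F θ' (W t)) (θ t j ω)‖ ^ 2) | 𝒢 t j]
        ≤ᵐ[μ] fun _ => σ ^ 2) :
    ∑ t ∈ range R, ∑ j ∈ range J,
        ∫ ω, ‖gradient (fun θ' => F θ' (W t)) (θ t j ω)‖ ^ 2 ∂μ
      ≤ (F θ₀ (W 0) - Fstar + R * LW * δ + R * J * Lg * η ^ 2 * σ ^ 2 / 2)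
          / (η * (1 - η * Lg / 2)) := by
  have hc : 0 < η * (1 - η * Lg / 2) := by
    have : η * Lg < 2 := (lt_div_iff₀ hLg).1 hη2
    apply mul_pos hη0
    linarith
  rw [le_div_iff₀ hc, mul_comm]
  set c := η * (1 - η * Lg / 2) with hcdef
  set K := Lg * η ^ 2 * σ ^ 2 / 2 with hK
  have hinner : ∀ t, t < R → ∀ n, n ≤ J →
      c * ∑ j ∈ range n, ∫ ω, ‖gradient (fun θ' => F θ' (W t)) (θ t j ω)‖ ^ 2 ∂μ
        ≤ ∫ ω, F (θ t 0 ω) (W t) ∂μ - ∫ ω, F (θ t n ω) (W t) ∂μ + n * K := by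
    intro t ht n
    induction n with
    | zero => intro _; simp
    | succ n ih =>
      intro hn
      have h1 := ih (by omega)
      have hu := hupd t ht n (by omega)
      have hF' := hFint t (n + 1)
      rw [hu] at hF'
      have h2 := aux_step (fun θ' => F θ' (W t)) Lg σ η hLg (hdiff _) (hsmooth _) (𝒢 t n) (h𝒢 t n)
        (θ t n) (G t n) (hadapt t n) (hGint t n) (hvarint t n) (hFint t n) hF' (hgradint t n)
        (hmean t ht n (by omega)) (hvar t ht n (by omega))
      rw [← hcdef, ← hK] at h2
      rw [sum_range_succ, mul_add, hu]
      push_cast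
      linarith
  have houter : ∀ n, n + 1 ≤ R →
      c * ∑ t ∈ range (n + 1), ∑ j ∈ range J,
          ∫ ω, ‖gradient (fun θ' => F θ' (W t)) (θ t j ω)‖ ^ 2 ∂μ
        ≤ F θ₀ (W 0) - ∫ ω, F (θ n J ω) (W n) ∂μ + n * (LW * δ) + (n + 1) * (J * K) := by
    intro n
    induction n with
    | zero =>
      intro hn
      have h := hinner 0 (by omega) J le_rfl
      simp only [hinit, integral_const, probReal_univ, one_smul] at h
      simp only [zero_add, sum_range_one, Nat.cast_zero]
      linarith
    | succ n ih =>
      intro hn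
      have h1 := ih (by omega)
      have h2 := hinner (n + 1) (by omega) J le_rfl
      have h3 : ∫ ω, F (θ (n + 1) 0 ω) (W (n + 1)) ∂μ
          ≤ ∫ ω, F (θ n J ω) (W n) ∂μ + LW * δ := by
        have := integral_mono (hFint (n + 1) 0) ((hFint n J).add (integrable_const (LW * δ)))
          (fun ω => by
            have h4 := (abs_le.1 (hLip (θ n J ω) (W (n + 1)) (W n))).2
            have h5 := mul_le_mul_of_nonneg_left (hW n (by omega)) hLW
            simp only [Pi.add_apply]
            rw [hlink n (by omega)]
            linarith)
        simp only [Pi.add_apply] at this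
        rwa [integral_add (hFint n J) (integrable_const _), integral_const, probReal_univ,
          one_smul] at this
      rw [sum_range_succ, mul_add]
      push_cast
      linarith
  have hLd : 0 ≤ LW * δ := mul_nonneg hLW hδ
  cases R with
  | zero =>
    have := hbdd θ₀ (W 0)
    simp
    linarith
  | succ n =>
    have h1 := houter n le_rfl
    have h2 : Fstar ≤ ∫ ω, F (θ n J ω) (W n) ∂μ := by
      have := integral_mono (integrable_const Fstar) (hFint n J) (fun ω => hbdd _ _)
      simpa using this
    refine h1.trans ?_
    push_cast
    rw [hK]
    linarith
end

section
/- The scaled softmax cross-entropy loss is √2·s-Lipschitz in the prototype matrix. Let s > 0, let D = {(x_1, y_1), …, (x_n, y_n)} be a finite dataset with labels y_i ∈ {1, …, m}, and let f(θ; ·) be a feature map whose outputs satisfy ‖f(θ; x_i)‖ = 1 for all i. Define F(θ; D, W, s) = (1/n) Σ_{i=1}^{n} ℓ(W, f(θ; x_i), y_i). Then for any two prototype matrices W, W′ ∈ ℝ^{m×d} and any θ, |F(θ; D, W, s) − F(θ; D, W′, s)| ≤ √2 · s · ‖W − W′‖_F, where ‖·‖_F denotes the Frobenius norm. -/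
open scoped RealInnerProductSpace
open Finset

/-- The scaled softmax cross-entropy loss for a prototype matrix `W` (given by its
rows `W 1, …, W m`), a feature vector `r`, a label `y` and a scale `s`:
`ℓ(W, r, y) = −log( exp(s⟨W_y, r⟩) / Σ_j exp(s⟨W_j, r⟩) )`. -/
noncomputable def scaledCrossEntropy {m d : ℕ} (s : ℝ)
    (W : Fin m → EuclideanSpace ℝ (Fin d)) (r : EuclideanSpace ℝ (Fin d))
    (y : Fin m) : ℝ :=
  - Real.log (Real.exp (s * ⟪W y, r⟫) / ∑ j, Real.exp (s * ⟪W j, r⟫))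

/-- The Frobenius norm of a matrix given by its rows. -/
noncomputable def frobeniusNorm {m d : ℕ}
    (W : Fin m → EuclideanSpace ℝ (Fin d)) : ℝ :=
  Real.sqrt (∑ j, ‖W j‖ ^ 2)

theorem lse_aux {m : ℕ} (a b : Fin m → ℝ) (y : Fin m) :
    (Real.log (∑ j, Real.exp (a j)) - a y) - (Real.log (∑ j, Real.exp (b j)) - b y)
      ≤ Real.sqrt 2 * Real.sqrt (∑ j, (a j - b j) ^ 2) := by
  have hne : (Finset.univ : Finset (Fin m)).Nonempty := ⟨y, Finset.mem_univ y⟩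
  have hZ : 0 < ∑ j, Real.exp (a j) := Finset.sum_pos (fun j _ => Real.exp_pos _) hne
  have hZb : 0 < ∑ j, Real.exp (b j) := Finset.sum_pos (fun j _ => Real.exp_pos _) hne
  obtain ⟨Z, hZd⟩ : ∃ Z, Z = ∑ j, Real.exp (a j) := ⟨_, rfl⟩
  rw [← hZd] at hZ ⊢
  obtain ⟨p, hp⟩ : ∃ p : Fin m → ℝ, p = fun j => Real.exp (a j) / Z := ⟨_, rfl⟩
  have hp0 : ∀ j, 0 ≤ p j := fun j => by rw [hp]; positivity
  have hp1 : ∑ j, p j = 1 := by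
    rw [hp, ← Finset.sum_div, ← hZd, div_self hZ.ne']
  have hple : ∀ j, p j ≤ 1 := fun j => by
    rw [← hp1]; exact Finset.single_le_sum (fun i _ => hp0 i) (Finset.mem_univ j)
  have hJ : Real.exp (∑ j, p j * (b j - a j)) ≤ ∑ j, p j * Real.exp (b j - a j) := by
    have := convexOn_exp.map_sum_le (t := Finset.univ) (w := p) (p := fun j => b j - a j)
      (fun i _ => hp0 i) hp1 (fun i _ => Set.mem_univ _)
    simpa using this
  have hE : ∑ j, p j * Real.exp (b j - a j) = (∑ j, Real.exp (b j)) / Z := by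
    rw [Finset.sum_div]
    refine Finset.sum_congr rfl fun j _ => ?_
    rw [hp, Real.exp_sub]
    have := Real.exp_pos (a j)
    field_simp
  have hL : ∑ j, p j * (b j - a j) ≤ Real.log (∑ j, Real.exp (b j)) - Real.log Z := by
    rw [← Real.log_div hZb.ne' hZ.ne', Real.le_log_iff_exp_le (by positivity), ← hE]
    exact hJ
  let e : Fin m → ℝ := fun j => if j = y then 1 else 0
  have hsum : ∑ j, (p j - e j) * (a j - b j) = -(∑ j, p j * (b j - a j)) - (a y - b y) := by
    have h1 : ∑ j, e j * (a j - b j) = a y - b y := by simp [e]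
    rw [← h1, ← Finset.sum_neg_distrib, ← Finset.sum_sub_distrib]
    exact Finset.sum_congr rfl fun j _ => by ring
  have hsq : ∑ j, (p j - e j) ^ 2 ≤ 2 := by
    have h1 : ∑ j, e j = 1 := by simp [e]
    calc ∑ j, (p j - e j) ^ 2 ≤ ∑ j, (p j + e j) := by
          refine Finset.sum_le_sum fun j _ => ?_
          have := hp0 j
          have := hple j
          by_cases h : j = y <;> simp only [e, h, if_true, if_false] <;> subst_vars <;> nlinarith
      _ = 2 := by rw [Finset.sum_add_distrib, hp1, h1]; norm_num
  have hCS := Real.sum_mul_le_sqrt_mul_sqrt Finset.univ (fun j => p j - e j) (fun j => a j - b j)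
  have h2 : Real.sqrt (∑ j, (p j - e j) ^ 2) * Real.sqrt (∑ j, (a j - b j) ^ 2)
      ≤ Real.sqrt 2 * Real.sqrt (∑ j, (a j - b j) ^ 2) :=
    mul_le_mul_of_nonneg_right (Real.sqrt_le_sqrt hsq) (Real.sqrt_nonneg _)
  linarith

theorem sce_aux {m d : ℕ} (s : ℝ) (hs : 0 < s) (W W' : Fin m → EuclideanSpace ℝ (Fin d))
    (r : EuclideanSpace ℝ (Fin d)) (hr : ‖r‖ = 1) (y : Fin m) :
    scaledCrossEntropy s W r y - scaledCrossEntropy s W' r y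
      ≤ Real.sqrt 2 * s * frobeniusNorm (fun j => W j - W' j) := by
  have key : ∀ V : Fin m → EuclideanSpace ℝ (Fin d), scaledCrossEntropy s V r y
      = Real.log (∑ j, Real.exp (s * ⟪V j, r⟫)) - s * ⟪V y, r⟫ := fun V => by
    have : 0 < ∑ j, Real.exp (s * ⟪V j, r⟫) :=
      Finset.sum_pos (fun j _ => Real.exp_pos _) ⟨y, Finset.mem_univ y⟩
    rw [scaledCrossEntropy, Real.log_div (Real.exp_pos _).ne' this.ne', Real.log_exp]
    ring
  rw [key, key]
  refine (lse_aux (fun j => s * ⟪W j, r⟫) (fun j => s * ⟪W' j, r⟫) y).trans ?_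
  rw [mul_assoc]
  refine mul_le_mul_of_nonneg_left ?_ (Real.sqrt_nonneg _)
  rw [frobeniusNorm]
  refine Real.sqrt_le_iff.2 ⟨mul_nonneg hs.le (Real.sqrt_nonneg _), ?_⟩
  rw [mul_pow, Real.sq_sqrt (Finset.sum_nonneg fun j _ => sq_nonneg _), Finset.mul_sum]
  refine Finset.sum_le_sum fun j _ => ?_
  rw [← mul_sub, ← inner_sub_left, mul_pow]
  refine mul_le_mul_of_nonneg_left ?_ (sq_nonneg s)
  have := abs_real_inner_le_norm (W j - W' j) r
  rw [hr, mul_one] at this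
  exact sq_le_sq' (abs_le.1 this).1 (abs_le.1 this).2

/-- **The scaled softmax cross-entropy loss is `√2·s`-Lipschitz in the prototype
matrix.**  For a dataset `(x i, y i)`, `i = 1, …, n`, and a feature map `f` with
unit-norm outputs `‖f θ (x i)‖ = 1`, the dataset-averaged loss
`F(θ; D, W, s) = (1/n) Σ_i ℓ(W, f θ (x i), y i)` satisfies
`|F(θ; D, W, s) − F(θ; D, W', s)| ≤ √2 · s · ‖W − W'‖_F`. -/
theorem scaledCrossEntropy_lipschitz_in_prototypes
    {m d n : ℕ} {X Θ : Type*} (s : ℝ) (hs : 0 < s)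
    (x : Fin n → X) (y : Fin n → Fin m)
    (f : Θ → X → EuclideanSpace ℝ (Fin d))
    (hf : ∀ (θ : Θ) (i : Fin n), ‖f θ (x i)‖ = 1)
    (θ : Θ) (W W' : Fin m → EuclideanSpace ℝ (Fin d)) :
    |(1 / (n : ℝ)) * ∑ i, scaledCrossEntropy s W (f θ (x i)) (y i)
        - (1 / (n : ℝ)) * ∑ i, scaledCrossEntropy s W' (f θ (x i)) (y i)|
      ≤ Real.sqrt 2 * s * frobeniusNorm (fun j => W j - W' j) := by
  have hC : 0 ≤ Real.sqrt 2 * s * frobeniusNorm (fun j => W j - W' j) := by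
    unfold frobeniusNorm; positivity
  have hsymm : frobeniusNorm (fun j => W' j - W j) = frobeniusNorm (fun j => W j - W' j) := by
    simp only [frobeniusNorm, norm_sub_rev]
  rw [← mul_sub, ← Finset.sum_sub_distrib, abs_mul, abs_of_nonneg (by positivity)]
  have hb : |∑ i, (scaledCrossEntropy s W (f θ (x i)) (y i)
      - scaledCrossEntropy s W' (f θ (x i)) (y i))|
      ≤ n * (Real.sqrt 2 * s * frobeniusNorm (fun j => W j - W' j)) := by
    refine (Finset.abs_sum_le_sum_abs _ _).trans ?_
    refine (Finset.sum_le_card_nsmul _ _ _ fun i _ => ?_).trans (by simp; rfl)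
    refine abs_le.2 ⟨?_, sce_aux s hs W W' _ (hf θ i) _⟩
    have := sce_aux s hs W' W _ (hf θ i) (y i)
    rw [hsymm] at this
    linarith
  rcases Nat.eq_zero_or_pos n with h | h
  · subst h; simpa using hC
  · have hn : (0 : ℝ) < n := by exact_mod_cast h
    rw [one_div, inv_mul_le_iff₀ hn]
    exact hb
end

section
/- Per-round prototype drift and induced loss change under the FedNH server update. Let ρ ∈ (1/2, 1] and let W^t ∈ ℝ^{m×d} have unit-norm rows. Suppose each row of W^{t+1} is obtained by W̃_c = ρ W_c^{t} + (1 − ρ) v_c with ‖v_c‖ ≤ 1 followed by normalization W_c^{t+1} = W̃_c/‖W̃_c‖. Then ‖W^{t+1} − W^t‖_F ≤ 4√m (1 − ρ). Consequently, for any θ, any scale s > 0, and any dataset D whose features satisfy ‖f(θ; x_i)‖ = 1, the dataset-averaged scaled softmax cross-entropy loss satisfies |F(θ; D, W^{t+1}, s) − F(θ; D, W^t, s)| ≤ 4√2 · s · √m · (1 − ρ). -/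
open scoped RealInnerProductSpace
open Finset

theorem aux_row {d : ℕ} (ρ : ℝ) (hρ₁ : 1 / 2 < ρ) (hρ₂ : ρ ≤ 1)
    (w u v : EuclideanSpace ℝ (Fin d)) (hw : ‖w‖ = 1) (hv : ‖v‖ ≤ 1)
    (hu : u = ‖ρ • w + (1 - ρ) • v‖⁻¹ • (ρ • w + (1 - ρ) • v)) :
    ‖u - w‖ ≤ 4 * (1 - ρ) := by
  set t := ρ • w + (1 - ρ) • v with ht
  have h1 : ‖t - w‖ ≤ 2 * (1 - ρ) := by
    have e : t - w = (1 - ρ) • (v - w) := by rw [ht]; module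
    rw [e, norm_smul, Real.norm_eq_abs, abs_of_nonneg (by linarith)]
    have := norm_sub_le v w
    nlinarith
  have h2 : |‖t‖ - 1| ≤ 2 * (1 - ρ) := by
    have := abs_norm_sub_norm_le t w
    rw [hw] at this
    linarith
  have h3 : 0 < ‖t‖ := by
    have := (abs_le.mp h2).1
    linarith
  have h4 : ‖u - t‖ ≤ 2 * (1 - ρ) := by
    have e : u - t = (‖t‖⁻¹ - 1) • t := by rw [hu]; module
    rw [e, norm_smul, Real.norm_eq_abs]
    have : |‖t‖⁻¹ - 1| * ‖t‖ = |‖t‖ - 1| := by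
      conv_lhs => rw [← abs_of_pos h3, ← abs_mul, abs_of_pos h3]
      rw [sub_mul, inv_mul_cancel₀ h3.ne', one_mul, abs_sub_comm]
    rw [this]; exact h2
  have := norm_sub_le_norm_sub_add_norm_sub u t w
  linarith

theorem aux_lse {m : ℕ} (y : Fin m) (a b : Fin m → ℝ) (ε : ℝ)
    (h : ∀ j, a j ≤ b j + ε) :
    Real.log (∑ j, Real.exp (a j)) ≤ Real.log (∑ j, Real.exp (b j)) + ε := by
  have hp : ∀ a : Fin m → ℝ, 0 < ∑ j, Real.exp (a j) := fun a =>
    Finset.sum_pos (fun j _ => Real.exp_pos _) ⟨y, Finset.mem_univ _⟩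
  have h1 : ∑ j, Real.exp (a j) ≤ (∑ j, Real.exp (b j)) * Real.exp ε := by
    rw [Finset.sum_mul]
    refine Finset.sum_le_sum fun j _ => ?_
    rw [← Real.exp_add]
    exact Real.exp_le_exp.mpr (h j)
  have h2 := Real.log_le_log (hp a) h1
  rwa [Real.log_mul (hp b).ne' (Real.exp_pos _).ne', Real.log_exp] at h2

theorem aux_sce {m d : ℕ} (s : ℝ) (W : Fin m → EuclideanSpace ℝ (Fin d))
    (r : EuclideanSpace ℝ (Fin d)) (y : Fin m) :
    scaledCrossEntropy s W r y =
      Real.log (∑ j, Real.exp (s * ⟪W j, r⟫)) - s * ⟪W y, r⟫ := by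
  have hp : 0 < ∑ j, Real.exp (s * ⟪W j, r⟫) :=
    Finset.sum_pos (fun j _ => Real.exp_pos _) ⟨y, Finset.mem_univ _⟩
  rw [scaledCrossEntropy, Real.log_div (Real.exp_pos _).ne' hp.ne', Real.log_exp]
  ring

theorem aux_loss {m d : ℕ} (s δ : ℝ) (hs : 0 < s) (hδ : 0 ≤ δ)
    (W W' : Fin m → EuclideanSpace ℝ (Fin d))
    (r : EuclideanSpace ℝ (Fin d)) (hr : ‖r‖ = 1) (y : Fin m)
    (h : ∀ j, ‖W' j - W j‖ ≤ δ) :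
    |scaledCrossEntropy s W' r y - scaledCrossEntropy s W r y|
      ≤ Real.sqrt 2 * s * Real.sqrt m * δ := by
  have hm : 0 < m := y.pos
  rcases Nat.lt_or_ge 1 m with h2 | h2
  · have hz : ∀ j, |s * ⟪W' j, r⟫ - s * ⟪W j, r⟫| ≤ s * δ := by
      intro j
      rw [← mul_sub, ← inner_sub_left, abs_mul, abs_of_pos hs]
      have := abs_real_inner_le_norm (W' j - W j) r
      rw [hr, mul_one] at this
      exact mul_le_mul_of_nonneg_left (this.trans (h j)) hs.le
    have l1 := aux_lse y (fun j => s * ⟪W' j, r⟫) (fun j => s * ⟪W j, r⟫) (s * δ)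
      (fun j => by have := (abs_le.mp (hz j)).2; linarith)
    have l2 := aux_lse y (fun j => s * ⟪W j, r⟫) (fun j => s * ⟪W' j, r⟫) (s * δ)
      (fun j => by have := (abs_le.mp (hz j)).1; linarith)
    have hy := abs_le.mp (hz y)
    have hq : 2 ≤ Real.sqrt 2 * Real.sqrt m := by
      rw [← Real.sqrt_mul (by norm_num)]
      apply Real.le_sqrt_of_sq_le
      have : (2 : ℝ) ≤ m := by exact_mod_cast h2
      linarith
    have hf : 2 * (s * δ) ≤ Real.sqrt 2 * s * Real.sqrt m * δ := by
      have := mul_le_mul_of_nonneg_right hq (mul_nonneg hs.le hδ)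
      linarith
    refine le_trans ?_ hf
    rw [aux_sce, aux_sce, abs_le]
    constructor <;> linarith [hy.1, hy.2]
  · obtain rfl : m = 1 := by omega
    have hy : y = 0 := Subsingleton.elim _ _
    have : ∀ W : Fin 1 → EuclideanSpace ℝ (Fin d), scaledCrossEntropy s W r y = 0 := by
      intro W
      rw [aux_sce, hy]; simp
    rw [this, this]; simp; positivity

/-- **Per-round prototype drift and induced loss change under the FedNH server
update.**  If the rows of `Wt` have unit norm and each row of `Wt1` is obtained by
the exponential smoothing `ρ • Wt c + (1 − ρ) • v c` with `‖v c‖ ≤ 1` followed by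
renormalization, then `‖Wt1 − Wt‖_F ≤ 4 √m (1 − ρ)`; consequently, for any `θ`,
scale `s > 0` and dataset with unit-norm features, the averaged scaled softmax
cross-entropy loss changes by at most `4 √2 s √m (1 − ρ)`. -/
theorem fednh_server_update_drift
    {m d n : ℕ} {X Θ : Type*} (ρ : ℝ) (hρ₁ : 1 / 2 < ρ) (hρ₂ : ρ ≤ 1)
    (Wt Wt1 v : Fin m → EuclideanSpace ℝ (Fin d))
    (hWt : ∀ c, ‖Wt c‖ = 1) (hv : ∀ c, ‖v c‖ ≤ 1)
    (hupd : ∀ c, Wt1 c =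
      ‖ρ • Wt c + (1 - ρ) • v c‖⁻¹ • (ρ • Wt c + (1 - ρ) • v c)) :
    frobeniusNorm (fun c => Wt1 c - Wt c) ≤ 4 * Real.sqrt m * (1 - ρ) ∧
    ∀ (s : ℝ), 0 < s →
      ∀ (x : Fin n → X) (y : Fin n → Fin m) (f : Θ → X → EuclideanSpace ℝ (Fin d)),
        (∀ (θ : Θ) (i : Fin n), ‖f θ (x i)‖ = 1) →
        ∀ θ : Θ,
          |(1 / (n : ℝ)) * ∑ i, scaledCrossEntropy s Wt1 (f θ (x i)) (y i)
              - (1 / (n : ℝ)) * ∑ i, scaledCrossEntropy s Wt (f θ (x i)) (y i)|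
            ≤ 4 * Real.sqrt 2 * s * Real.sqrt m * (1 - ρ) := by
  have hrow : ∀ c, ‖Wt1 c - Wt c‖ ≤ 4 * (1 - ρ) := fun c =>
    aux_row ρ hρ₁ hρ₂ _ _ _ (hWt c) (hv c) (hupd c)
  have hδ : 0 ≤ 4 * (1 - ρ) := by linarith
  constructor
  · have : ∑ c, ‖Wt1 c - Wt c‖ ^ 2 ≤ m * (4 * (1 - ρ)) ^ 2 := by
      calc _ ≤ ∑ _c : Fin m, (4 * (1 - ρ)) ^ 2 :=
            Finset.sum_le_sum fun c _ => pow_le_pow_left₀ (norm_nonneg _) (hrow c) 2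
        _ = _ := by simp
    calc _ ≤ Real.sqrt (m * (4 * (1 - ρ)) ^ 2) := Real.sqrt_le_sqrt this
      _ = _ := by rw [Real.sqrt_mul (by positivity), Real.sqrt_sq hδ]; ring
  · intro s hs x y f hf θ
    rw [← mul_sub, ← Finset.sum_sub_distrib, abs_mul, abs_of_nonneg (by positivity)]
    have hB : 4 * Real.sqrt 2 * s * Real.sqrt m * (1 - ρ)
        = Real.sqrt 2 * s * Real.sqrt m * (4 * (1 - ρ)) := by ring
    rw [hB]
    set B := Real.sqrt 2 * s * Real.sqrt m * (4 * (1 - ρ)) with hBd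
    have hB0 : 0 ≤ B := by positivity
    have hsum : |∑ i, (scaledCrossEntropy s Wt1 (f θ (x i)) (y i)
        - scaledCrossEntropy s Wt (f θ (x i)) (y i))| ≤ n * B := by
      refine (Finset.abs_sum_le_sum_abs _ _).trans ?_
      calc _ ≤ ∑ _i : Fin n, B := Finset.sum_le_sum fun i _ =>
            aux_loss s _ hs hδ Wt Wt1 _ (hf θ i) (y i) hrow
        _ = _ := by simp
    rcases Nat.eq_zero_or_pos n with h0 | h0
    · subst h0; simpa using hB0
    · have hn : (0 : ℝ) < n := by exact_mod_cast h0
      rw [one_div, inv_mul_le_iff₀ hn]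
      exact hsum
end
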